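/- Let d₁, d₂ be odd positive integers with d₁ ∣ d₂ and D = diag(d₁,d₂). Let q₁(x₁,x₂,x₃,x₄) = x₁x₃ + x₂x₄ + x₁ + x₃ be the odd quadratic form on 𝔽₂⁴, and define Γ₂(d₁,d₂)⁻ = {Z ∈ Γ_D(D) : the entrywise mod-2 reduction Z̄ of Z satisfies q₁(Z̄x) = q₁(x) for all x ∈ 𝔽₂⁴}. Then Γ₂(d₁,d₂)⁻ is a subgroup of Γ_D(D) of index 6. -/

import Mathlib

open Matrix

/-- The matrix `J_D = [[0, D], [−D, 0]]` over `ℤ`, for `D = diag(d₁,d₂)`. -/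
def JD (d1 d2 : ℤ) : Matrix (Fin 4) (Fin 4) ℤ :=
  !![0, 0, d1, 0; 0, 0, 0, d2; -d1, 0, 0, 0; 0, -d2, 0, 0]

/-- The vector `(d₁, d₂, d₁, d₂)` of row divisibilities. -/
def dvec (d1 d2 : ℤ) : Fin 4 → ℤ := ![d1, d2, d1, d2]

/-- Membership in `Γ_D(D)`: `M·J_D·Mᵀ = J_D` and each block of `M − I₄` is of the form
`D·Y`, i.e. rows `0,2` of `M − I₄` are divisible by `d₁` and rows `1,3` by `d₂`. -/
def InGammaDD (d1 d2 : ℤ) (M : Matrix (Fin 4) (Fin 4) ℤ) : Prop :=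
  M * JD d1 d2 * Mᵀ = JD d1 d2 ∧ ∀ i j, dvec d1 d2 i ∣ (M - 1) i j

/-- Entrywise reduction modulo 2 of an integer matrix. -/
def red2 (M : Matrix (Fin 4) (Fin 4) ℤ) : Matrix (Fin 4) (Fin 4) (ZMod 2) :=
  M.map (Int.cast)

/-- The odd quadratic form `q₁(x₁,x₂,x₃,x₄) = x₁x₃ + x₂x₄ + x₁ + x₃` on `𝔽₂⁴`
(0-based indices). -/
def q1 (x : Fin 4 → ZMod 2) : ZMod 2 :=
  x 0 * x 2 + x 1 * x 3 + x 0 + x 2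

abbrev V4 := Fin 4 → ZMod 2
abbrev U4 := (Matrix (Fin 4) (Fin 4) ℤ)ˣ

/-- Functions on `𝔽₂⁴`, a type synonym carrying the action below. -/
def Fm := V4 → ZMod 2

theorem red2_mul (A B : Matrix (Fin 4) (Fin 4) ℤ) : red2 (A * B) = red2 A * red2 B :=
  Matrix.map_mul (f := Int.castRingHom (ZMod 2))

theorem red2_one : red2 1 = 1 :=
  Matrix.map_one (Int.cast : ℤ → ZMod 2) Int.cast_zero Int.cast_one

instance actFm : MulAction U4 Fm where
  smul g f := fun x => f ((red2 ((g⁻¹ : U4) : Matrix (Fin 4) (Fin 4) ℤ)).mulVec x)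
  one_smul f := by
    funext x
    change f ((red2 (((1 : U4)⁻¹ : U4) : Matrix (Fin 4) (Fin 4) ℤ)).mulVec x) = f x
    simp [red2_one]
  mul_smul g h f := by
    funext x
    change f ((red2 (((g * h)⁻¹ : U4) : Matrix (Fin 4) (Fin 4) ℤ)).mulVec x) =
      f ((red2 ((h⁻¹ : U4) : Matrix (Fin 4) (Fin 4) ℤ)).mulVec
        ((red2 ((g⁻¹ : U4) : Matrix (Fin 4) (Fin 4) ℤ)).mulVec x))
    rw [_root_.mul_inv_rev, Units.val_mul, red2_mul, Matrix.mulVec_mulVec]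

theorem smul_Fm (g : U4) (f : Fm) (x : V4) :
    (g • f) x = f ((red2 ((g⁻¹ : U4) : Matrix (Fin 4) (Fin 4) ℤ)).mulVec x) := rfl

theorem dvd_iff_exists (d1 d2 : ℤ) (M : Matrix (Fin 4) (Fin 4) ℤ) :
    (∀ i j, dvec d1 d2 i ∣ (M - 1) i j) ↔
      ∃ Y, M = 1 + Matrix.diagonal (dvec d1 d2) * Y := by
  constructor
  · intro h
    choose Y hY using h
    refine ⟨Matrix.of Y, ?_⟩
    ext i j
    have := hY i j
    rw [Matrix.sub_apply] at this
    rw [Matrix.add_apply, Matrix.diagonal_mul, Matrix.of_apply]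
    linarith
  · rintro ⟨Y, rfl⟩ i j
    rw [add_sub_cancel_left, Matrix.diagonal_mul]
    exact dvd_mul_right _ _

theorem JDconj_mul {a b J : Matrix (Fin 4) (Fin 4) ℤ} (ha : a * J * aᵀ = J)
    (hb : b * J * bᵀ = J) : a * b * J * (bᵀ * aᵀ) = J := by
  calc _ = a * (b * J * bᵀ) * aᵀ := by simp only [Matrix.mul_assoc]
    _ = _ := by rw [hb, ha]

theorem JDconj_inv {a b J : Matrix (Fin 4) (Fin 4) ℤ} (ha : a * J * aᵀ = J)
    (e1 : b * a = 1) (e3 : aᵀ * bᵀ = 1) : b * J * bᵀ = J := by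
  calc b * J * bᵀ = b * (a * J * aᵀ) * bᵀ := by rw [ha]
    _ = (b * a) * J * (aᵀ * bᵀ) := by simp only [Matrix.mul_assoc]
    _ = _ := by rw [e1, e3, Matrix.one_mul, Matrix.mul_one]

/-- `Γ_D(D)` as a subgroup of the unit group. -/
def GG (d1 d2 : ℤ) : Subgroup U4 where
  carrier := {R | InGammaDD d1 d2 (R : Matrix (Fin 4) (Fin 4) ℤ)}
  one_mem' := by
    refine ⟨by simp, by simp⟩
  mul_mem' := by
    rintro a b ⟨ha, ha'⟩ ⟨hb, hb'⟩
    rw [dvd_iff_exists] at ha' hb'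
    refine ⟨?_, ?_⟩
    · rw [Units.val_mul, Matrix.transpose_mul]
      exact JDconj_mul ha hb
    · rw [dvd_iff_exists]
      obtain ⟨Y, hY⟩ := ha'
      obtain ⟨Z, hZ⟩ := hb'
      refine ⟨Y + Z + Y * Matrix.diagonal (dvec d1 d2) * Z, ?_⟩
      rw [Units.val_mul, hY, hZ]
      noncomm_ring
  inv_mem' := by
    rintro a ⟨ha, ha'⟩
    rw [dvd_iff_exists] at ha'
    have e1 : ((a⁻¹ : U4) : Matrix (Fin 4) (Fin 4) ℤ) * a = 1 := a.inv_mul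
    have e2 : (a : Matrix (Fin 4) (Fin 4) ℤ) * ((a⁻¹ : U4) : Matrix (Fin 4) (Fin 4) ℤ) = 1 :=
      a.mul_inv
    refine ⟨?_, ?_⟩
    · generalize ((a⁻¹ : U4) : Matrix (Fin 4) (Fin 4) ℤ) = b at *
      have e3 : (a : Matrix (Fin 4) (Fin 4) ℤ)ᵀ * bᵀ = 1 := by
        rw [← Matrix.transpose_mul, e1, Matrix.transpose_one]
      exact JDconj_inv ha e1 e3
    · rw [dvd_iff_exists]
      obtain ⟨Y, hY⟩ := ha'
      generalize ((a⁻¹ : U4) : Matrix (Fin 4) (Fin 4) ℤ) = b at *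
      refine ⟨-(Y * b), ?_⟩
      rw [hY, Matrix.add_mul, Matrix.one_mul] at e2
      rw [← e2]
      noncomm_ring

/-- The quadratic form `q₁ + l`. -/
def ql (l : V4) : Fm := fun x => q1 x + ∑ i, x i * l i

/-- The six linear forms `l` such that `q₁ + l` is odd. -/
def SS : Finset V4 :=
  {![0,0,0,0], ![0,0,0,1], ![0,1,0,0], ![0,1,1,1], ![1,1,1,1], ![1,1,0,1]}

theorem SS_card : SS.card = 6 := by decide

theorem ql_inj : Function.Injective ql := by
  intro l m h
  funext i
  have := congrFun h (Pi.single i 1)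
  simpa [ql, Pi.single_apply] using this

set_option maxRecDepth 100000 in
theorem count_SS : ∀ l : V4,
    (Finset.univ.filter fun x : V4 => q1 x + ∑ i, x i * l i = 0).card = 6 → l ∈ SS := by
  decide +kernel

theorem count_q1 : (Finset.univ.filter fun x : V4 => q1 x = 0).card = 6 := by
  decide +kernel

def K2 : Matrix (Fin 4) (Fin 4) (ZMod 2) := !![0,0,1,0; 0,0,0,1; 1,0,0,0; 0,1,0,0]

theorem K2_sq : K2 * K2 = 1 := by decide +kernel

theorem q1_add (x y : V4) : q1 (x + y) = q1 x + q1 y + x ⬝ᵥ (K2.mulVec y) := by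
  simp [q1, K2, dotProduct, Matrix.mulVec, Fin.sum_univ_four]
  ring

theorem cast_odd {d : ℤ} (h : Odd d) : (d : ZMod 2) = 1 := by
  obtain ⟨k, rfl⟩ := h
  push_cast
  rw [show (2 : ZMod 2) = 0 from rfl]
  ring

theorem red2_JD {d1 d2 : ℤ} (h1 : Odd d1) (h2 : Odd d2) : red2 (JD d1 d2) = K2 := by
  have e : (-1 : ZMod 2) = 1 := rfl
  ext i j
  fin_cases i <;> fin_cases j <;> simp [red2, JD, K2, cast_odd h1, cast_odd h2, e]

theorem symp {d1 d2 : ℤ} (h1 : Odd d1) (h2 : Odd d2) {M : Matrix (Fin 4) (Fin 4) ℤ}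
    (h : InGammaDD d1 d2 M) : (red2 M)ᵀ * K2 * red2 M = K2 := by
  have h := congrArg red2 h.1
  rw [red2_mul, red2_mul, red2_JD h1 h2] at h
  have ht : red2 Mᵀ = (red2 M)ᵀ := rfl
  rw [ht] at h
  generalize red2 M = R at *
  have a : R * (K2 * Rᵀ * K2) = 1 := by
    rw [← K2_sq, ← Matrix.mul_assoc, ← Matrix.mul_assoc, h]
  have b := mul_eq_one_comm.mp a
  calc Rᵀ * K2 * R = (K2 * K2) * (Rᵀ * K2 * R) := by rw [K2_sq, Matrix.one_mul]
    _ = K2 * (K2 * Rᵀ * K2 * R) := by simp only [Matrix.mul_assoc]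
    _ = K2 := by rw [b, Matrix.mul_one]

theorem orbit_sub {R S : Matrix (Fin 4) (Fin 4) (ZMod 2)} (h : Rᵀ * K2 * R = K2)
    (hRS : R * S = 1) : ∃ l ∈ SS, (fun x => q1 (R.mulVec x) : Fm) = ql l := by
  have hSR := mul_eq_one_comm.mp hRS
  have hB : ∀ x y, R.mulVec x ⬝ᵥ K2.mulVec (R.mulVec y) = x ⬝ᵥ K2.mulVec y := by
    intro x y
    conv_rhs => rw [← h, ← Matrix.mulVec_mulVec, ← Matrix.mulVec_mulVec, Matrix.dotProduct_mulVec x,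
      Matrix.vecMul_transpose]
  let g : V4 →+ ZMod 2 := AddMonoidHom.mk' (fun x => q1 (R.mulVec x) - q1 x) (by
    intro x y
    rw [Matrix.mulVec_add, q1_add, q1_add, hB]
    ring)
  have hg : ∀ x, g x = ∑ i, x i * g (Pi.single i 1) := by
    intro x
    have := LinearMap.pi_apply_eq_sum_univ (AddMonoidHom.toZModLinearMap 2 g) x
    have e : ∀ i : Fin 4, (fun j => if i = j then (1 : ZMod 2) else 0) = Pi.single i 1 := by
      intro i
      funext j
      simp [Pi.single_apply, eq_comm]
    simpa [e] using this
  have key : ∀ x, q1 (R.mulVec x) = q1 x + ∑ i, x i * g (Pi.single i 1) := by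
    intro x
    rw [← hg]
    change _ = q1 x + (q1 (R.mulVec x) - q1 x)
    ring
  refine ⟨fun i => g (Pi.single i 1), ?_, funext key⟩
  apply count_SS
  rw [← count_q1]
  refine Finset.card_bij' (fun x _ => R.mulVec x) (fun x _ => S.mulVec x) ?_ ?_ ?_ ?_
  · intro x hx
    simpa [key] using hx
  · intro x hx
    simp only [Finset.mem_filter, Finset.mem_univ, true_and] at hx ⊢
    rw [← key, Matrix.mulVec_mulVec, hRS, Matrix.one_mulVec, hx]
  · intro x _
    rw [Matrix.mulVec_mulVec, hSR, Matrix.one_mulVec]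
  · intro x _
    rw [Matrix.mulVec_mulVec, hRS, Matrix.one_mulVec]

theorem step {d1 d2 : ℤ} (A B : Matrix (Fin 4) (Fin 4) ℤ) (C : Matrix (Fin 4) (Fin 4) (ZMod 2))
    (hAB : A * B = 1) (hA : InGammaDD d1 d2 A) (hC : red2 B = C) {l m : V4}
    (hlm : ∀ x, ql l (C.mulVec x) = ql m x)
    (hl : ql l ∈ MulAction.orbit (GG d1 d2) (ql 0)) :
    ql m ∈ MulAction.orbit (GG d1 d2) (ql 0) := by
  let g : GG d1 d2 := ⟨⟨A, B, hAB, mul_eq_one_comm.mp hAB⟩, hA⟩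
  have : ql m = g • ql l := by
    funext x
    rw [← hlm, ← hC]
    rfl
  rw [this]
  exact MulAction.mem_orbit_of_mem_orbit g hl

theorem step_U22 {d1 d2 : ℤ} (h1 : Odd d1) (h2 : Odd d2) {l m : V4}
    (hlm : ∀ x, ql l ((!![1, 0, 0, 0; 0, 1, 0, 1; 0, 0, 1, 0; 0, 0, 0, 1] : Matrix (Fin 4) (Fin 4) (ZMod 2)).mulVec x) = ql m x)
    (hl : ql l ∈ MulAction.orbit (GG d1 d2) (ql 0)) :
    ql m ∈ MulAction.orbit (GG d1 d2) (ql 0) := by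
  refine step !![1, 0, 0, 0; 0, 1, 0, d2; 0, 0, 1, 0; 0, 0, 0, 1] !![1, 0, 0, 0; 0, 1, 0, -d2; 0, 0, 1, 0; 0, 0, 0, 1] _ ?_ ⟨?_, ?_⟩ ?_ hlm hl
  · ext i j
    fin_cases i <;> fin_cases j <;> simp [Matrix.mul_apply, Fin.sum_univ_four]
  · ext i j
    fin_cases i <;> fin_cases j <;>
      simp [Matrix.mul_apply, Fin.sum_univ_four, JD]
  · intro i j
    fin_cases i <;> fin_cases j <;> simp [dvec]
  · have e : (-1 : ZMod 2) = 1 := rfl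
    ext i j
    fin_cases i <;> fin_cases j <;> simp [red2, cast_odd h1, cast_odd h2, e]

theorem step_L22 {d1 d2 : ℤ} (h1 : Odd d1) (h2 : Odd d2) {l m : V4}
    (hlm : ∀ x, ql l ((!![1, 0, 0, 0; 0, 1, 0, 0; 0, 0, 1, 0; 0, 1, 0, 1] : Matrix (Fin 4) (Fin 4) (ZMod 2)).mulVec x) = ql m x)
    (hl : ql l ∈ MulAction.orbit (GG d1 d2) (ql 0)) :
    ql m ∈ MulAction.orbit (GG d1 d2) (ql 0) := by
  refine step !![1, 0, 0, 0; 0, 1, 0, 0; 0, 0, 1, 0; 0, d2, 0, 1] !![1, 0, 0, 0; 0, 1, 0, 0; 0, 0, 1, 0; 0, -d2, 0, 1] _ ?_ ⟨?_, ?_⟩ ?_ hlm hl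
  · ext i j
    fin_cases i <;> fin_cases j <;> simp [Matrix.mul_apply, Fin.sum_univ_four]
  · ext i j
    fin_cases i <;> fin_cases j <;>
      simp [Matrix.mul_apply, Fin.sum_univ_four, JD]
  · intro i j
    fin_cases i <;> fin_cases j <;> simp [dvec]
  · have e : (-1 : ZMod 2) = 1 := rfl
    ext i j
    fin_cases i <;> fin_cases j <;> simp [red2, cast_odd h1, cast_odd h2, e]

theorem step_U12 {d1 d2 : ℤ} (h1 : Odd d1) (h2 : Odd d2) {l m : V4}
    (hlm : ∀ x, ql l ((!![1, 0, 0, 1; 0, 1, 1, 0; 0, 0, 1, 0; 0, 0, 0, 1] : Matrix (Fin 4) (Fin 4) (ZMod 2)).mulVec x) = ql m x)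
    (hl : ql l ∈ MulAction.orbit (GG d1 d2) (ql 0)) :
    ql m ∈ MulAction.orbit (GG d1 d2) (ql 0) := by
  refine step !![1, 0, 0, d1; 0, 1, d2, 0; 0, 0, 1, 0; 0, 0, 0, 1] !![1, 0, 0, -d1; 0, 1, -d2, 0; 0, 0, 1, 0; 0, 0, 0, 1] _ ?_ ⟨?_, ?_⟩ ?_ hlm hl
  · ext i j
    fin_cases i <;> fin_cases j <;> simp [Matrix.mul_apply, Fin.sum_univ_four]
  · ext i j
    fin_cases i <;> fin_cases j <;>
      simp [Matrix.mul_apply, Fin.sum_univ_four, JD]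
  · intro i j
    fin_cases i <;> fin_cases j <;> simp [dvec]
  · have e : (-1 : ZMod 2) = 1 := rfl
    ext i j
    fin_cases i <;> fin_cases j <;> simp [red2, cast_odd h1, cast_odd h2, e]

theorem step_L11 {d1 d2 : ℤ} (h1 : Odd d1) (h2 : Odd d2) {l m : V4}
    (hlm : ∀ x, ql l ((!![1, 0, 0, 0; 0, 1, 0, 0; 1, 0, 1, 0; 0, 0, 0, 1] : Matrix (Fin 4) (Fin 4) (ZMod 2)).mulVec x) = ql m x)
    (hl : ql l ∈ MulAction.orbit (GG d1 d2) (ql 0)) :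
    ql m ∈ MulAction.orbit (GG d1 d2) (ql 0) := by
  refine step !![1, 0, 0, 0; 0, 1, 0, 0; d1, 0, 1, 0; 0, 0, 0, 1] !![1, 0, 0, 0; 0, 1, 0, 0; -d1, 0, 1, 0; 0, 0, 0, 1] _ ?_ ⟨?_, ?_⟩ ?_ hlm hl
  · ext i j
    fin_cases i <;> fin_cases j <;> simp [Matrix.mul_apply, Fin.sum_univ_four]
  · ext i j
    fin_cases i <;> fin_cases j <;>
      simp [Matrix.mul_apply, Fin.sum_univ_four, JD]
  · intro i j
    fin_cases i <;> fin_cases j <;> simp [dvec]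
  · have e : (-1 : ZMod 2) = 1 := rfl
    ext i j
    fin_cases i <;> fin_cases j <;> simp [red2, cast_odd h1, cast_odd h2, e]

theorem step_U11 {d1 d2 : ℤ} (h1 : Odd d1) (h2 : Odd d2) {l m : V4}
    (hlm : ∀ x, ql l ((!![1, 0, 1, 0; 0, 1, 0, 0; 0, 0, 1, 0; 0, 0, 0, 1] : Matrix (Fin 4) (Fin 4) (ZMod 2)).mulVec x) = ql m x)
    (hl : ql l ∈ MulAction.orbit (GG d1 d2) (ql 0)) :
    ql m ∈ MulAction.orbit (GG d1 d2) (ql 0) := by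
  refine step !![1, 0, d1, 0; 0, 1, 0, 0; 0, 0, 1, 0; 0, 0, 0, 1] !![1, 0, -d1, 0; 0, 1, 0, 0; 0, 0, 1, 0; 0, 0, 0, 1] _ ?_ ⟨?_, ?_⟩ ?_ hlm hl
  · ext i j
    fin_cases i <;> fin_cases j <;> simp [Matrix.mul_apply, Fin.sum_univ_four]
  · ext i j
    fin_cases i <;> fin_cases j <;>
      simp [Matrix.mul_apply, Fin.sum_univ_four, JD]
  · intro i j
    fin_cases i <;> fin_cases j <;> simp [dvec]
  · have e : (-1 : ZMod 2) = 1 := rfl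
    ext i j
    fin_cases i <;> fin_cases j <;> simp [red2, cast_odd h1, cast_odd h2, e]

theorem SS_sub {d1 d2 : ℤ} (h1 : Odd d1) (h2 : Odd d2) :
    ∀ l ∈ SS, ql l ∈ MulAction.orbit (GG d1 d2) (ql 0) := by
  have a0 : ql 0 ∈ MulAction.orbit (GG d1 d2) (ql 0) := MulAction.mem_orbit_self _
  have a1 := step_U22 h1 h2 (m := ![0,0,0,1]) (by unfold ql; decide +kernel) a0
  have a2 := step_L22 h1 h2 (m := ![0,1,0,0]) (by unfold ql; decide +kernel) a0
  have a3 := step_U12 h1 h2 (m := ![0,1,1,1]) (by unfold ql; decide +kernel) a2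
  have a4 := step_L11 h1 h2 (m := ![1,1,1,1]) (by unfold ql; decide +kernel) a3
  have a5 := step_U11 h1 h2 (m := ![1,1,0,1]) (by unfold ql; decide +kernel) a4
  have e : (![0,0,0,0] : V4) = 0 := by decide
  intro l hl
  simp only [SS, Finset.mem_insert, Finset.mem_singleton] at hl
  rcases hl with rfl | rfl | rfl | rfl | rfl | rfl
  · rwa [e]
  all_goals assumption

theorem orbit_eq {d1 d2 : ℤ} (h1 : Odd d1) (h2 : Odd d2) :
    MulAction.orbit (GG d1 d2) (ql 0) = ql '' (SS : Set V4) := by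
  apply Set.Subset.antisymm
  · rintro _ ⟨g, rfl⟩
    have hg : InGammaDD d1 d2 (((g : U4)⁻¹ : U4) : Matrix (Fin 4) (Fin 4) ℤ) := (g⁻¹).2
    obtain ⟨l, hl, h⟩ := orbit_sub (S := red2 ((g : U4) : Matrix (Fin 4) (Fin 4) ℤ))
      (symp h1 h2 hg) (by rw [← red2_mul, Units.inv_mul, red2_one])
    refine ⟨l, hl, ?_⟩
    rw [← h]
    funext x
    change _ = ql 0 _
    simp [ql]
  · rintro _ ⟨l, hl, rfl⟩
    exact SS_sub h1 h2 l hl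

theorem stab_iff (R : U4) : R ∈ MulAction.stabilizer U4 (ql 0) ↔
    ∀ x : V4, q1 ((red2 (R : Matrix (Fin 4) (Fin 4) ℤ)).mulVec x) = q1 x := by
  rw [← inv_mem_iff, MulAction.mem_stabilizer_iff]
  constructor
  · intro h x
    have := congrFun h x
    rw [smul_Fm] at this
    simpa [ql] using this
  · intro h
    funext x
    rw [smul_Fm]
    simpa [ql] using h x

/-- For odd positive `d₁ ∣ d₂`, the set `Γ₂(d₁,d₂)⁻` of elements of `Γ_D(D)` whose mod-2
reduction preserves the odd quadratic form `q₁` is a subgroup of `Γ_D(D)` of index 6.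
(Elements of `Γ_D(D)` are units of the matrix ring, and both sets are subgroups of the
unit group.) -/
theorem statement11 (d1 d2 : ℤ) (h1 : Odd d1) (h1p : 0 < d1) (h2 : Odd d2) (h2p : 0 < d2)
    (hdvd : d1 ∣ d2) :
    ∃ G H : Subgroup (Matrix (Fin 4) (Fin 4) ℤ)ˣ,
      (G : Set (Matrix (Fin 4) (Fin 4) ℤ)ˣ) =
        {R : (Matrix (Fin 4) (Fin 4) ℤ)ˣ | InGammaDD d1 d2 (R : Matrix (Fin 4) (Fin 4) ℤ)} ∧
      (H : Set (Matrix (Fin 4) (Fin 4) ℤ)ˣ) =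
        {R : (Matrix (Fin 4) (Fin 4) ℤ)ˣ | InGammaDD d1 d2 (R : Matrix (Fin 4) (Fin 4) ℤ) ∧
          ∀ x : Fin 4 → ZMod 2,
            q1 ((red2 (R : Matrix (Fin 4) (Fin 4) ℤ)).mulVec x) = q1 x} ∧
      H ≤ G ∧ H.relIndex G = 6 := by
  refine ⟨GG d1 d2, GG d1 d2 ⊓ MulAction.stabilizer U4 (ql 0), rfl, ?_, inf_le_left, ?_⟩
  · ext R
    exact and_congr Iff.rfl (stab_iff R)
  · rw [Subgroup.inf_relIndex_left]
    have : (MulAction.stabilizer U4 (ql 0)).subgroupOf (GG d1 d2) =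
        MulAction.stabilizer (GG d1 d2) (ql 0) := rfl
    rw [Subgroup.relIndex, this, MulAction.index_stabilizer, orbit_eq h1 h2,
      Set.ncard_image_of_injective _ ql_inj, Set.ncard_coe_finset, SS_card]
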